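/- Let k ≥ 1, let F = GaloisField 2 (2k), let i ≥ 0 be an integer, let t1, t2 be integers with 0 ≤ t1, t2 ≤ k, and let γ1, γ2 be elements of the subfield F_{2^k}. Assume that the only z ∈ F_{2^k} with γ1^{2^{k−t1}} z^{2^{k−t1}} + γ2^{2^{k−t2}} z^{2^{k−t2}} + z = 0 is z = 0, and the only z ∈ F_{2^k} with γ1^{2^{k−i}} z^{2^{t1}} + γ2^{2^{k−i}} z^{2^{t2}} + z = 0 is z = 0. Then for α ∈ F, the Boolean function F_α^i(x) = Tr(α x^{2^i} (x + x^{2^k} + γ1(x^{2^{t1}} + x^{2^{t1+k}}) + γ2(x^{2^{t2}} + x^{2^{t2+k}}))) is bent if and only if α^{2^k} ≠ α. -/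

import Mathlib

open Finset

noncomputable instance (n : ℕ) : Fintype (GaloisField 2 n) := Fintype.ofFinite _

/-- The absolute trace of `GaloisField 2 n` over `ZMod 2`. -/
noncomputable def gTr (n : ℕ) : GaloisField 2 n → ZMod 2 :=
  Algebra.trace (ZMod 2) (GaloisField 2 n)

/-- A Boolean function on `GaloisField 2 n` is bent if all its Walsh values
square to `2^n`. -/
def IsBent {n : ℕ} (f : GaloisField 2 n → ZMod 2) : Prop :=
  ∀ lam : GaloisField 2 n,
    (∑ x : GaloisField 2 n, (-1 : ℤ) ^ (f x + gTr n (lam * x)).val) ^ 2 = 2 ^ n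

theorem neg_one_pow_val_add (a b : ZMod 2) :
    (-1 : ℤ) ^ (a + b).val = (-1) ^ a.val * (-1) ^ b.val := by
  revert a b
  decide

/-- A sign sum vanishes if some translation flips every sign. -/
theorem sum_sign_eq_zero {G : Type*} [AddCommGroup G] [Fintype G] (h : G → ZMod 2) (u : G)
    (hu : ∀ x, h (x + u) = h x + 1) : ∑ x, (-1 : ℤ) ^ (h x).val = 0 := by
  have key : ∑ x, (-1 : ℤ) ^ (h x).val = -∑ x, (-1 : ℤ) ^ (h x).val := by
    rw [← Finset.sum_neg_distrib, ← Equiv.sum_comp (Equiv.addRight u)]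
    refine Finset.sum_congr rfl fun x _ => ?_
    rw [Equiv.coe_addRight, hu, neg_one_pow_val_add, ZMod.val_one, pow_one, mul_neg_one]
  linarith

/-- If all nontrivial autocorrelations of a sign function vanish, its sum squares to the order
of the group. -/
theorem sq_sum_sign_eq_card {G : Type*} [AddCommGroup G] [Fintype G] (g : G → ZMod 2)
    (hg : ∀ z ≠ 0, ∑ x, (-1 : ℤ) ^ (g x + g (x + z)).val = 0) :
    (∑ x, (-1 : ℤ) ^ (g x).val) ^ 2 = Fintype.card G := by
  classical
  have shift (x : G) : ∑ y, (-1 : ℤ) ^ (g x).val * (-1) ^ (g y).val =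
      ∑ z, (-1 : ℤ) ^ (g x + g (x + z)).val := by
    rw [← Equiv.sum_comp (Equiv.addLeft x)]
    simp only [Equiv.coe_addLeft, neg_one_pow_val_add]
  rw [sq, Finset.sum_mul_sum, Finset.sum_congr rfl fun x _ => shift x, Finset.sum_comm,
    Finset.sum_eq_single 0 (fun z _ hz => hg z hz) (by simp)]
  simp [CharTwo.add_self_eq_zero]

theorem gTr_add (n : ℕ) (x y : GaloisField 2 n) : gTr n (x + y) = gTr n x + gTr n y :=
  map_add _ x y

theorem gTr_pow_two_pow (n j : ℕ) (x : GaloisField 2 n) : gTr n (x ^ 2 ^ j) = gTr n x := by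
  induction j with
  | zero => simp
  | succ j ih =>
    rw [pow_succ, pow_mul, ← ih]
    have := Algebra.trace_eq_of_algEquiv
      (FiniteField.frobeniusAlgEquivOfAlgebraic (ZMod 2) (GaloisField 2 n)) (x ^ 2 ^ j)
    simpa [gTr, ZMod.card] using this

theorem eq_zero_of_gTr_mul_eq_zero {n : ℕ} {a : GaloisField 2 n}
    (h : ∀ y, gTr n (a * y) = 0) : a = 0 := by
  exact (traceForm_nondegenerate (ZMod 2) (GaloisField 2 n)).1 a h

theorem pow_two_pow_two_mul (k : ℕ) (hk : 1 ≤ k) (x : GaloisField 2 (2 * k)) :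
    (x ^ 2 ^ k) ^ 2 ^ k = x := by
  have h := FiniteField.pow_card x
  rw [← Nat.card_eq_fintype_card, GaloisField.card 2 (2 * k) (by omega)] at h
  rw [← pow_mul, ← pow_add, ← two_mul, h]

/-- The relative trace `x + x ^ 2 ^ k` to the subfield with `2 ^ k` elements. -/
noncomputable def relTr (k : ℕ) : GaloisField 2 (2 * k) →+ GaloisField 2 (2 * k) :=
  AddMonoidHom.id _ + (iterateFrobenius (GaloisField 2 (2 * k)) 2 k : _ →+ _)

theorem relTr_apply (k : ℕ) (x : GaloisField 2 (2 * k)) : relTr k x = x + x ^ 2 ^ k := rfl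

theorem relTr_pow_two_pow (k : ℕ) (hk : 1 ≤ k) (x : GaloisField 2 (2 * k)) :
    relTr k x ^ 2 ^ k = relTr k x := by
  rw [relTr_apply, add_pow_expChar_pow, pow_two_pow_two_mul k hk, add_comm]

theorem relTr_eq_zero_iff (k : ℕ) (x : GaloisField 2 (2 * k)) :
    relTr k x = 0 ↔ x ^ 2 ^ k = x := by
  rw [relTr_apply, CharTwo.add_eq_zero, eq_comm]

theorem relTr_mul (k : ℕ) {a : GaloisField 2 (2 * k)} (ha : a ^ 2 ^ k = a)
    (x : GaloisField 2 (2 * k)) : relTr k (a * x) = a * relTr k x := by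
  rw [relTr_apply, relTr_apply, mul_pow, ha, mul_add]

theorem relTr_pow (k j : ℕ) (x : GaloisField 2 (2 * k)) :
    relTr k (x ^ 2 ^ j) = relTr k x ^ 2 ^ j := by
  rw [relTr_apply, relTr_apply, add_pow_expChar_pow, pow_right_comm]

theorem gTr_relTr (k : ℕ) (x : GaloisField 2 (2 * k)) : gTr (2 * k) (relTr k x) = 0 := by
  rw [relTr_apply, gTr_add, gTr_pow_two_pow, CharTwo.add_self_eq_zero]

theorem pow_two_pow_eq_self_of_gTr_mul_relTr (k : ℕ) (hk : 1 ≤ k) {a : GaloisField 2 (2 * k)}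
    (h : ∀ y, gTr (2 * k) (a * relTr k y) = 0) : a ^ 2 ^ k = a := by
  rw [← relTr_eq_zero_iff]
  refine eq_zero_of_gTr_mul_eq_zero fun y => ?_
  have hy := h y
  rw [relTr_apply, mul_add, gTr_add, ← gTr_pow_two_pow _ k (a * y ^ 2 ^ k), mul_pow,
    pow_two_pow_two_mul k hk] at hy
  rw [relTr_apply, add_mul, gTr_add, hy]

/-- The linearized trinomial `x + γ1 x ^ 2 ^ t1 + γ2 x ^ 2 ^ t2`. -/
noncomputable def linTrinomial {n : ℕ} (t1 t2 : ℕ) (γ1 γ2 : GaloisField 2 n) :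
    GaloisField 2 n →+ GaloisField 2 n :=
  AddMonoidHom.id _ +
    (AddMonoidHom.mulLeft γ1).comp (iterateFrobenius (GaloisField 2 n) 2 t1 : _ →+ _) +
    (AddMonoidHom.mulLeft γ2).comp (iterateFrobenius (GaloisField 2 n) 2 t2 : _ →+ _)

theorem linTrinomial_apply {n : ℕ} (t1 t2 : ℕ) (γ1 γ2 x : GaloisField 2 n) :
    linTrinomial t1 t2 γ1 γ2 x = x + γ1 * x ^ 2 ^ t1 + γ2 * x ^ 2 ^ t2 := rfl

theorem relTr_linTrinomial {k : ℕ} (t1 t2 : ℕ) {γ1 γ2 : GaloisField 2 (2 * k)}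
    (hγ1 : γ1 ^ 2 ^ k = γ1) (hγ2 : γ2 ^ 2 ^ k = γ2) (x : GaloisField 2 (2 * k)) :
    relTr k (linTrinomial t1 t2 γ1 γ2 x) = linTrinomial t1 t2 γ1 γ2 (relTr k x) := by
  simp only [linTrinomial_apply, map_add, relTr_mul k hγ1, relTr_mul k hγ2, relTr_pow]

/-- A function `Tr (α Q(x) M(x))` with `Q`, `M` additive is bent if its polar form is
nondegenerate. -/
theorem isBent_of_polar_nondegenerate {n : ℕ} (hn : n ≠ 0) (α : GaloisField 2 n)
    (Q M : GaloisField 2 n →+ GaloisField 2 n)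
    (h : ∀ z, (∀ u, gTr n (α * Q u * M z) + gTr n (α * Q z * M u) = 0) → z = 0) :
    IsBent fun x => gTr n (α * Q x * M x) := by
  intro lam
  rw [sq_sum_sign_eq_card (fun x => gTr n (α * Q x * M x) + gTr n (lam * x))]
  · rw [← Nat.card_eq_fintype_card, GaloisField.card 2 n hn]
    norm_cast
  intro z hz
  obtain ⟨u, hu⟩ := not_forall.1 (mt (h z) hz)
  refine sum_sign_eq_zero _ u fun x => ?_
  have hu : _ = (1 : ZMod 2) := Fin.eq_one_of_ne_zero _ hu
  rw [← hu]
  simp only [map_add, mul_add, add_mul, gTr_add]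
  grind

theorem not_isBent_of_periodic {n : ℕ} (f : GaloisField 2 n → ZMod 2) {u : GaloisField 2 n}
    (hu : u ≠ 0) (hf : ∀ x, f (x + u) = f x) : ¬ IsBent f := by
  intro hb
  obtain ⟨lam, hlam⟩ := not_forall.1 (mt (eq_zero_of_gTr_mul_eq_zero (a := u)) hu)
  have hlam : _ = (1 : ZMod 2) := Fin.eq_one_of_ne_zero _ hlam
  have hW := hb lam
  rw [sum_sign_eq_zero _ u fun x => ?_] at hW
  · exact absurd hW (by positivity)
  · rw [hf, mul_add, gTr_add, mul_comm lam u, hlam, add_assoc]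

theorem stmt_9 (k : ℕ) (hk : 1 ≤ k) (i t1 t2 : ℕ) (ht1 : t1 ≤ k) (ht2 : t2 ≤ k)
    (γ1 γ2 : GaloisField 2 (2 * k))
    (hγ1 : γ1 ^ 2 ^ k = γ1) (hγ2 : γ2 ^ 2 ^ k = γ2)
    (h1 : ∀ z : GaloisField 2 (2 * k), z ^ 2 ^ k = z →
      γ1 ^ 2 ^ (k - t1) * z ^ 2 ^ (k - t1) + γ2 ^ 2 ^ (k - t2) * z ^ 2 ^ (k - t2) + z = 0 →
      z = 0)
    (h2 : ∀ z : GaloisField 2 (2 * k), z ^ 2 ^ k = z →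
      γ1 ^ 2 ^ (k - i) * z ^ 2 ^ t1 + γ2 ^ 2 ^ (k - i) * z ^ 2 ^ t2 + z = 0 → z = 0)
    (α : GaloisField 2 (2 * k)) :
    IsBent (fun x : GaloisField 2 (2 * k) =>
      gTr (2 * k) (α * x ^ 2 ^ i *
        (x + x ^ 2 ^ k + γ1 * (x ^ 2 ^ t1 + x ^ 2 ^ (t1 + k)) +
          γ2 * (x ^ 2 ^ t2 + x ^ 2 ^ (t2 + k))))) ↔
      α ^ 2 ^ k ≠ α := by
  set L := linTrinomial t1 t2 γ1 γ2 with hL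
  set M : GaloisField 2 (2 * k) →+ GaloisField 2 (2 * k) := L.comp (relTr k) with hM
  set Q : GaloisField 2 (2 * k) →+ GaloisField 2 (2 * k) :=
    (iterateFrobenius (GaloisField 2 (2 * k)) 2 i).toAddMonoidHom
  have hQ (x) : Q x = x ^ 2 ^ i := rfl
  have hMT (x) : M x = relTr k (L x) := (relTr_linTrinomial t1 t2 hγ1 hγ2 x).symm
  have hf : (fun x : GaloisField 2 (2 * k) =>
      gTr (2 * k) (α * x ^ 2 ^ i *
        (x + x ^ 2 ^ k + γ1 * (x ^ 2 ^ t1 + x ^ 2 ^ (t1 + k)) +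
          γ2 * (x ^ 2 ^ t2 + x ^ 2 ^ (t2 + k))))) =
      fun x => gTr (2 * k) (α * Q x * M x) := by
    funext x
    simp only [hQ, hM, hL, AddMonoidHom.comp_apply, linTrinomial_apply, ← relTr_pow]
    simp only [relTr_apply, pow_add, pow_mul]
  have hLinj : ∀ w, w ^ 2 ^ k = w → L w = 0 → w = 0 := by
    intro w hw h0
    have hz := h2 (w ^ 2 ^ (k - i)) (by rw [pow_right_comm, hw]) <| by
      have h := congrArg (· ^ 2 ^ (k - i)) h0
      simp only [hL, linTrinomial_apply, add_pow_expChar_pow, mul_pow] at h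
      rw [zero_pow (by positivity), pow_right_comm w (2 ^ t1), pow_right_comm w (2 ^ t2)] at h
      rw [← h]
      ring
    exact eq_zero_of_pow_eq_zero hz
  rw [hf]
  constructor
  · intro hb hα
    refine not_isBent_of_periodic _ one_ne_zero (fun x => ?_) hb
    have h1 : M 1 = 0 := by
      rw [hM, AddMonoidHom.comp_apply, (relTr_eq_zero_iff k 1).2 (one_pow _), map_zero]
    rw [map_add, map_add, h1, add_zero, hQ 1, one_pow, mul_add, add_mul, gTr_add, mul_one, hMT x,
      ← relTr_mul k hα, gTr_relTr, add_zero]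
  · intro hα
    refine isBent_of_polar_nondegenerate (by omega) α Q M fun z hz => ?_
    have hMz : M z = 0 := by
      have hfix : (α * M z) ^ 2 ^ k = α * M z := by
        refine pow_two_pow_eq_self_of_gTr_mul_relTr k hk fun y => ?_
        obtain ⟨v, rfl⟩ := (bijective_iterateFrobenius (GaloisField 2 (2 * k)) 2 i).2 y
        have hMv : M (relTr k v) = 0 := by
          rw [hM, AddMonoidHom.comp_apply,
            (relTr_eq_zero_iff k _).2 (relTr_pow_two_pow k hk v), map_zero]
        have h := hz (relTr k v)
        rw [hMv, mul_zero, hQ, ← relTr_pow] at h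
        rw [iterateFrobenius_def, mul_right_comm]
        simpa [gTr] using h
      by_contra hne
      rw [mul_pow, hMT, relTr_pow_two_pow k hk, ← hMT] at hfix
      exact hα (mul_right_cancel₀ hne hfix)
    have hTz : z ^ 2 ^ k = z :=
      (relTr_eq_zero_iff k z).1 (hLinj _ (relTr_pow_two_pow k hk z) hMz)
    have hsurj : ∀ y, ∃ x, M x = relTr k y := by
      let φ : (relTr k).range → (relTr k).range := fun w =>
        ⟨L w, by obtain ⟨_, x, rfl⟩ := w; exact ⟨L x, relTr_linTrinomial t1 t2 hγ1 hγ2 x⟩⟩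
      have hφ : Function.Injective φ := by
        rintro ⟨_, a, rfl⟩ ⟨_, b, rfl⟩ hab
        have hab : L (relTr k a) = L (relTr k b) := congrArg Subtype.val hab
        rw [← sub_eq_zero, ← map_sub, ← map_sub] at hab
        have h := hLinj _ (relTr_pow_two_pow k hk _) hab
        rw [map_sub, sub_eq_zero] at h
        exact Subtype.ext h
      intro y
      obtain ⟨⟨_, x, rfl⟩, hx⟩ := Finite.surjective_of_injective hφ ⟨relTr k y, y, rfl⟩
      exact ⟨x, congrArg Subtype.val hx⟩
    have hfix : (α * Q z) ^ 2 ^ k = α * Q z := by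
      refine pow_two_pow_eq_self_of_gTr_mul_relTr k hk fun y => ?_
      obtain ⟨x, hx⟩ := hsurj y
      have h := hz x
      rw [hMz, mul_zero, hx] at h
      simpa [gTr] using h
    rw [mul_pow, hQ, pow_right_comm z, hTz] at hfix
    by_contra hne
    exact hα (mul_right_cancel₀ (pow_ne_zero _ hne) hfix)
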